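/- arXiv:1902.07064 — 2 statements merged into one kernel-verified Lean document; each statement's English description precedes it below -/
import Mathlib

section
/- Let ρ > 0, α ∈ ℝ, β ∈ ℝ, and set κ = β²/2 + β. Then ∫₀^∞ (1 + ρz)^α·[ 1 + β·(1 − (1/2)(1+ρz)^{−2}) + (β²/2)·(1 − (1+ρz)^{−2}) ]·e^{−z} dz = e^{1/ρ}·ρ^α·[ (κ+1)·Γ(α+1, 1/ρ) − ((κ − β/2)/ρ²)·Γ(α−1, 1/ρ) ], where Γ(s,x) = ∫_x^∞ t^{s−1} e^{−t} dt is the upper incomplete gamma function. -/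
open MeasureTheory Set Real

/-- The upper incomplete gamma function `Γ(s,x) = ∫_x^∞ t^{s−1} e^{−t} dt`. -/
noncomputable def upperGamma (s x : ℝ) : ℝ :=
  ∫ t in Set.Ioi x, t ^ (s - 1) * Real.exp (-t)

/-- The integrand of `upperGamma s x` is integrable for every real `s` when `0 < x`. -/
theorem integrableOn_upperGamma_integrand (s : ℝ) {x : ℝ} (hx : 0 < x) :
    IntegrableOn (fun t : ℝ => t ^ (s - 1) * Real.exp (-t)) (Set.Ioi x) := by
  refine integrable_of_isBigO_exp_neg one_half_pos ?_ ?_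
  · refine ContinuousOn.mul (fun t ht => ?_) (by fun_prop)
    exact (continuousAt_rpow_const t _ (Or.inl (hx.trans_le ht).ne')).continuousWithinAt
  · simpa only [mul_comm] using (Gamma_integrand_isLittleO (s - 1)).isBigO

theorem setIntegral_Ioi_zero_comp_add_right (g : ℝ → ℝ) (c : ℝ) :
    ∫ z in Set.Ioi (0 : ℝ), g (z + c) = ∫ t in Set.Ioi c, g t := by
  simpa using (measurePreserving_add_right volume c).setIntegral_preimage_emb
    (measurableEmbedding_addRight c) g (Set.Ioi c)

/-- for `ρ > 0`, real `α, β`, and `κ = β²/2 + β`,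
`∫₀^∞ (1+ρz)^α [1 + β(1 − (1/2)(1+ρz)^{−2}) + (β²/2)(1 − (1+ρz)^{−2})] e^{−z} dz
  = e^{1/ρ} ρ^α [(κ+1)Γ(α+1,1/ρ) − ((κ−β/2)/ρ²)Γ(α−1,1/ρ)]`. -/
theorem core_integral_identity (ρ α β κ : ℝ) (hρ : 0 < ρ) (hκ : κ = β ^ 2 / 2 + β) :
    ∫ z in Set.Ioi (0:ℝ),
        (1 + ρ * z) ^ α *
          (1 + β * (1 - 1 / 2 * (1 + ρ * z) ^ (-2 : ℝ)) +
            β ^ 2 / 2 * (1 - (1 + ρ * z) ^ (-2 : ℝ))) * Real.exp (-z) =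
      Real.exp (1 / ρ) * ρ ^ α *
        ((κ + 1) * upperGamma (α + 1) (1 / ρ) -
          (κ - β / 2) / ρ ^ 2 * upperGamma (α - 1) (1 / ρ)) := by
  have hx : 0 < 1 / ρ := one_div_pos.mpr hρ
  have h₁ := (integrableOn_upperGamma_integrand (α + 1) hx).const_mul (κ + 1)
  have h₂ := (integrableOn_upperGamma_integrand (α - 1) hx).const_mul ((κ - β / 2) / ρ ^ 2)
  unfold upperGamma
  rw [← integral_const_mul, ← integral_const_mul, ← integral_sub h₁ h₂, ← integral_const_mul,
    ← setIntegral_Ioi_zero_comp_add_right _ (1 / ρ)]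
  refine setIntegral_congr_fun measurableSet_Ioi fun z hz => ?_
  have ht : 0 < z + 1 / ρ := add_pos hz hx
  have hscale : 1 + ρ * z = ρ * (z + 1 / ρ) := by field_simp; ring
  have hexp : Real.exp (-(z + 1 / ρ)) = Real.exp (-z) * (Real.exp (1 / ρ))⁻¹ := by
    rw [neg_add, Real.exp_add, Real.exp_neg (1 / ρ)]
  have hneg : ∀ y : ℝ, 0 < y → y ^ (-2 : ℝ) = (y ^ 2)⁻¹ := fun y hy => by
    rw [rpow_neg hy.le, rpow_two]
  have hpow : (z + 1 / ρ) ^ (α - 1 - 1) = (z + 1 / ρ) ^ α * ((z + 1 / ρ) ^ 2)⁻¹ := by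
    rw [← hneg _ ht, ← rpow_add ht]
    ring_nf
  simp only [hscale, hneg _ (mul_pos hρ ht), mul_rpow hρ.le ht.le, hexp, hpow,
    add_sub_cancel_right, hκ]
  generalize z + 1 / ρ = t at ht ⊢
  have hE := Real.exp_ne_zero (1 / ρ)
  generalize Real.exp (1 / ρ) = E at hE ⊢
  field_simp
  ring
end

section
/- Let ρ > 0, α ∈ ℝ, and β ≥ 0, and set κ = β²/2 + β. Then 𝒥(ρ) := e^{1/ρ}·ρ^α·[ (κ+1)·Γ(α+1, 1/ρ) − ((κ − β/2)/ρ²)·Γ(α−1, 1/ρ) ] > 0, where Γ(s,x) = ∫_x^∞ t^{s−1} e^{−t} dt is the upper incomplete gamma function. -/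
open MeasureTheory Set Real

theorem integrableOn_rpow_mul_exp_neg_Ioi (s : ℝ) {x : ℝ} (hx : 0 < x) :
    IntegrableOn (fun t : ℝ => t ^ s * Real.exp (-t)) (Set.Ioi x) := by
  refine integrable_of_isBigO_exp_neg (b := 1 / 2) (by norm_num) ?_ ?_
  · intro t ht
    have ht0 : t ≠ 0 := (hx.trans_le ht).ne'
    exact ((Real.continuousAt_rpow_const t s (Or.inl ht0)).mul
      (by fun_prop)).continuousWithinAt
  · have h := (Real.Gamma_integrand_isLittleO s).isBigO
    simpa [mul_comm] using h

theorem upperGamma_pos (s : ℝ) {x : ℝ} (hx : 0 < x) : 0 < upperGamma s x := by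
  have hpos : ∀ t ∈ Set.Ioi x, 0 < t ^ (s - 1) * Real.exp (-t) := fun t ht =>
    mul_pos (Real.rpow_pos_of_pos (hx.trans ht) _) (Real.exp_pos _)
  unfold upperGamma
  rw [setIntegral_pos_iff_support_of_nonneg_ae
    (ae_restrict_of_forall_mem measurableSet_Ioi fun t ht => (hpos t ht).le)
    (integrableOn_rpow_mul_exp_neg_Ioi _ hx)]
  rw [Set.inter_eq_right.mpr fun t ht => Function.mem_support.mpr (hpos t ht).ne']
  simp

/-- Lowering the parameter by two costs at most a factor `x ^ 2`. -/
theorem sq_mul_upperGamma_le (s : ℝ) {x : ℝ} (hx : 0 < x) :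
    x ^ 2 * upperGamma (s - 1) x ≤ upperGamma (s + 1) x := by
  unfold upperGamma
  rw [← integral_const_mul]
  refine setIntegral_mono_on ((integrableOn_rpow_mul_exp_neg_Ioi _ hx).const_mul _)
    (integrableOn_rpow_mul_exp_neg_Ioi _ hx) measurableSet_Ioi fun t ht => ?_
  have ht0 : 0 < t := hx.trans ht
  have hsplit : t ^ (s + 1 - 1) = t ^ 2 * t ^ (s - 1 - 1) := by
    rw [← Real.rpow_natCast t 2, ← Real.rpow_add ht0]
    congr 1
    push_cast
    ring
  have hsq : x ^ 2 ≤ t ^ 2 := pow_le_pow_left₀ hx.le (le_of_lt ht) 2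
  rw [hsplit, ← mul_assoc]
  gcongr

/-- for `ρ > 0`, real `α`, `β ≥ 0`, and `κ = β²/2 + β`, the closed-form quantity
`𝒥(ρ) = e^{1/ρ} ρ^α [(κ+1)Γ(α+1,1/ρ) − ((κ−β/2)/ρ²)Γ(α−1,1/ρ)]` is strictly positive. -/
theorem closed_form_J_pos (ρ α β κ : ℝ) (hρ : 0 < ρ) (hβ : 0 ≤ β) (hκ : κ = β ^ 2 / 2 + β) :
    0 < Real.exp (1 / ρ) * ρ ^ α *
        ((κ + 1) * upperGamma (α + 1) (1 / ρ) -
          (κ - β / 2) / ρ ^ 2 * upperGamma (α - 1) (1 / ρ)) := by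
  have hx : 0 < 1 / ρ := one_div_pos.mpr hρ
  refine mul_pos (mul_pos (Real.exp_pos _) (Real.rpow_pos_of_pos hρ _)) ?_
  have hG := upperGamma_pos (α + 1) hx
  have hle := sq_mul_upperGamma_le α hx
  have hc : 0 ≤ κ - β / 2 := by nlinarith [sq_nonneg β]
  have hbound : (κ - β / 2) / ρ ^ 2 * upperGamma (α - 1) (1 / ρ) ≤
      (κ - β / 2) * upperGamma (α + 1) (1 / ρ) := by
    calc (κ - β / 2) / ρ ^ 2 * upperGamma (α - 1) (1 / ρ)
        = (κ - β / 2) * ((1 / ρ) ^ 2 * upperGamma (α - 1) (1 / ρ)) := by ring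
      _ ≤ _ := mul_le_mul_of_nonneg_left hle hc
  nlinarith [mul_nonneg hβ hG.le]
end
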